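/- arXiv:1908.01661 — 2 statements merged into one kernel-verified Lean document; each statement's English description precedes it below -/
import Mathlib

section
/- For every logic L, the following are equivalent: (i) truth is almost parametrically equationally definable in Mod* L; (ii) for every algebra A, the Leibniz operator Ω^A is completely order-reflecting on Fi_L A ∖ {∅}; (iii) Ω is completely order-reflecting on Th L ∖ {∅}. Moreover, in this case the parametrized equational translation τ(x,ȳ) := Ω̃_L C_L{x} (the Suszko congruence of the theory generated by x, viewed as a set of equations with parameters the variables other than x) almost defines truth in Mod* L. -/
universe u

/-- An algebraic type (signature): a set of function symbols with finite arities. -/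
structure AlgSig : Type (u + 1) where
  F : Type u
  ar : F → ℕ

/-- Terms (formulas) over a signature, with a countably infinite set `ℕ` of variables. -/
inductive Trm (S : AlgSig.{u}) : Type u
  | var : ℕ → Trm S
  | app : (f : S.F) → (Fin (S.ar f) → Trm S) → Trm S

/-- An algebra of a given signature. -/
structure AlgStr (S : AlgSig.{u}) : Type (u + 1) where
  α : Type u
  op : (f : S.F) → (Fin (S.ar f) → α) → α

variable {S : AlgSig.{u}}

/-- Evaluation of a term in an algebra under a valuation (equivalently, the unique
homomorphism from the term algebra determined by the valuation). -/
def Trm.eval (A : AlgStr S) (v : ℕ → A.α) : Trm S → A.α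
  | .var n => v n
  | .app f t => A.op f fun i => Trm.eval A v (t i)

/-- Substitution (an endomorphism of the term algebra). -/
def Trm.subst (σ : ℕ → Trm S) : Trm S → Trm S
  | .var n => σ n
  | .app f t => .app f fun i => Trm.subst σ (t i)

/-- All variables occurring in the term are `< n`. -/
def Trm.varsLT (n : ℕ) : Trm S → Prop
  | .var m => m < n
  | .app _ t => ∀ i, Trm.varsLT n (t i)

/-- The absolutely free term algebra `Fm`. -/
def TrmAlg (S : AlgSig.{u}) : AlgStr S :=
  ⟨Trm S, Trm.app⟩

/-- A congruence of an algebra. -/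
def IsCong (A : AlgStr S) (θ : A.α → A.α → Prop) : Prop :=
  Equivalence θ ∧
    ∀ (f : S.F) (x y : Fin (S.ar f) → A.α), (∀ i, θ (x i) (y i)) → θ (A.op f x) (A.op f y)

/-- A relation is compatible with a subset `F`. -/
def CompatWith {β : Type u} (θ : β → β → Prop) (F : Set β) : Prop :=
  ∀ a b, θ a b → a ∈ F → b ∈ F

/-- The Leibniz congruence `Ω^A F`: the largest congruence of `A` compatible with `F`
(the union of all congruences compatible with `F`). -/
def Leibniz (A : AlgStr S) (F : Set A.α) : A.α → A.α → Prop :=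
  fun a b => ∃ θ, IsCong A θ ∧ CompatWith θ F ∧ θ a b

/-- A matrix `⟨A, F⟩` is reduced if its Leibniz congruence is the identity relation. -/
def IsReducedMatrix (A : AlgStr S) (F : Set A.α) : Prop :=
  ∀ a b, Leibniz A F a b ↔ a = b

/-- A logic: a structural closure operator on sets of formulas. -/
structure Logic (S : AlgSig.{u}) where
  C : Set (Trm S) → Set (Trm S)
  monotone : ∀ ⦃Γ Δ : Set (Trm S)⦄, Γ ⊆ Δ → C Γ ⊆ C Δ
  extensive : ∀ Γ, Γ ⊆ C Γ
  idem : ∀ Γ, C (C Γ) ⊆ C Γ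
  structural : ∀ (σ : ℕ → Trm S) (Γ : Set (Trm S)),
    Trm.subst σ '' C Γ ⊆ C (Trm.subst σ '' Γ)

/-- Deductive filter of a logic over an algebra. -/
def IsDedFilter (Lo : Logic S) (A : AlgStr S) (Fl : Set A.α) : Prop :=
  ∀ (Γ : Set (Trm S)) (φ : Trm S), φ ∈ Lo.C Γ →
    ∀ v : ℕ → A.α, (∀ γ ∈ Γ, Trm.eval A v γ ∈ Fl) → Trm.eval A v φ ∈ Fl

/-- Theories of a logic: the deductive filters over the term algebra. -/
def Theories (Lo : Logic S) : Set (Set (Trm S)) :=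
  {Γ | IsDedFilter Lo (TrmAlg S) Γ}

/-- The deductive filter generated by a set. -/
def FgFilter (Lo : Logic S) (A : AlgStr S) (X : Set A.α) : Set A.α :=
  {a | ∀ G, IsDedFilter Lo A G → X ⊆ G → a ∈ G}

/-- The Suszko congruence of `F` relative to a logic: the intersection of the Leibniz
congruences of all deductive filters extending `F`. -/
def Suszko (Lo : Logic S) (A : AlgStr S) (F : Set A.α) : A.α → A.α → Prop :=
  fun a b => ∀ G, IsDedFilter Lo A G → F ⊆ G → Leibniz A G a b

/-- Unary polynomial functions of an algebra. -/
def IsUnaryPoly (A : AlgStr S) (p : A.α → A.α) : Prop :=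
  ∃ (φ : Trm S) (v : ℕ → A.α), ∀ a, p a = Trm.eval A (Function.update v 0 a) φ

/-- The set of solutions `τ(A)` of a parametrized equational translation `τ(x, ȳ)`,
where the distinguished variable `x` is variable `0` and the parameters are bound by a
universal quantifier. -/
def solSet (A : AlgStr S) (τ : Set (Trm S × Trm S)) : Set A.α :=
  {a | ∀ (v : ℕ → A.α), ∀ e ∈ τ,
    Trm.eval A (Function.update v 0 a) e.1 = Trm.eval A (Function.update v 0 a) e.2}

/-- `τ` defines truth in `Mod* L`. -/
def DefinesTruth (Lo : Logic S) (τ : Set (Trm S × Trm S)) : Prop :=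
  ∀ (A : AlgStr S) (F : Set A.α), IsDedFilter Lo A F → IsReducedMatrix A F →
    solSet A τ = F

/-- `τ` almost defines truth in `Mod* L` (i.e. on its non-almost-trivial members). -/
def AlmostDefinesTruth (Lo : Logic S) (τ : Set (Trm S × Trm S)) : Prop :=
  ∀ (A : AlgStr S) (F : Set A.α), IsDedFilter Lo A F → IsReducedMatrix A F →
    F.Nonempty → solSet A τ = F

/-- Only the distinguished variable `x` (variable `0`) occurs: no parameters. -/
def Trm.noParams : Trm S → Prop
  | .var n => n = 0
  | .app _ t => ∀ i, Trm.noParams (t i)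

/-- An equational translation: a set of equations in the single variable `x`. -/
def IsEqTranslation (τ : Set (Trm S × Trm S)) : Prop :=
  ∀ e ∈ τ, Trm.noParams e.1 ∧ Trm.noParams e.2

/-- The quotient of an algebra by a relation (intended: by a congruence). -/
noncomputable def quotAlg (A : AlgStr S) (r : A.α → A.α → Prop) : AlgStr S :=
  ⟨Quot r, fun f x => Quot.mk r (A.op f fun i => (x i).out)⟩
variable {S : AlgSig.{u}}

/-- Homomorphisms between algebras of the same signature. -/
structure AlgHomS (A B : AlgStr S) where
  toFun : A.α → B.α
  map_op : ∀ (f : S.F) (x : Fin (S.ar f) → A.α),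
    toFun (A.op f x) = B.op f fun i => toFun (x i)

/-- The Leibniz operator is completely order-reflecting on a family `X` of subsets. -/
def ComplOrderReflOn (A : AlgStr S) (X : Set (Set A.α)) : Prop :=
  ∀ (Fam : Set (Set A.α)) (G : Set A.α), Fam ⊆ X → G ∈ X →
    (∀ a b, (∀ F ∈ Fam, Leibniz A F a b) → Leibniz A G a b) → ⋂₀ Fam ⊆ G

/-- A Fregean logic: every Frege relation `Λ_L Γ` is a congruence of the term algebra. -/
def Fregean (Lo : Logic S) : Prop :=
  ∀ Γ : Set (Trm S),
    IsCong (TrmAlg S) fun φ ψ => ψ ∈ Lo.C (Γ ∪ {φ}) ∧ φ ∈ Lo.C (Γ ∪ {ψ})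

/-- A protoalgebraic logic: there is a set `Δ(x,y)` of formulas in two variables with
`∅ ⊢ Δ(x,x)` and `{x} ∪ Δ(x,y) ⊢ y`. -/
def Protoalgebraic (Lo : Logic S) : Prop :=
  ∃ Δ : Set (Trm S), (∀ d ∈ Δ, Trm.varsLT 2 d) ∧
    (∀ d ∈ Δ, Trm.subst (fun _ => Trm.var 0) d ∈ Lo.C ∅) ∧
    Trm.var 1 ∈ Lo.C ({Trm.var 0} ∪ Δ)

/-- The binary term `a ∧ b` built from a binary function symbol `m`. -/
def binT (m : S.F) (hm : S.ar m = 2) (a b : Trm S) : Trm S :=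
  Trm.app m fun i => ![a, b] (Fin.cast hm i)

/-- The binary operation of an algebra induced by a binary function symbol `m`. -/
def binA (A : AlgStr S) (m : S.F) (hm : S.ar m = 2) (a b : A.α) : A.α :=
  A.op m fun i => ![a, b] (Fin.cast hm i)

/-- A subuniverse (universe of a subalgebra). -/
def Subuniv (A : AlgStr S) (B : Set A.α) : Prop :=
  ∀ (f : S.F) (x : Fin (S.ar f) → A.α), (∀ i, x i ∈ B) → A.op f x ∈ B

/-- The subuniverse generated by a set. -/
def Sg (A : AlgStr S) (X : Set A.α) : Set A.α :=
  ⋂₀ {B | Subuniv A B ∧ X ⊆ B}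

/-- A subuniverse is `κ`-generated if it is generated by a subset of cardinality `≤ κ`. -/
def KGenerated (A : AlgStr S) (κ : Cardinal.{u}) (B : Set A.α) : Prop :=
  ∃ X : Set A.α, Cardinal.mk X ≤ κ ∧ Sg A X = B

/-- The subalgebra with universe a given subuniverse. -/
def subAlg (A : AlgStr S) (B : Set A.α) (hB : Subuniv A B) : AlgStr S :=
  ⟨B, fun f x => ⟨A.op f fun i => (x i).1, hB f _ fun i => (x i).2⟩⟩

/-- The signature expanded with a single new constant symbol `1`. -/
def expSig (S : AlgSig.{u}) : AlgSig.{u} :=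
  ⟨S.F ⊕ PUnit, Sum.elim S.ar fun _ => 0⟩

/-- The inclusion of the original terms into the terms of the expanded signature. -/
def Trm.incl : Trm S → Trm (expSig S)
  | .var n => .var n
  | .app f t => .app (Sum.inl f) fun i => Trm.incl (t i)

inductive Transl (A : AlgStr S) : (A.α → A.α) → Prop
  | id : Transl A (fun a => a)
  | step (f : S.F) (i : Fin (S.ar f)) (z : Fin (S.ar f) → A.α) (p : A.α → A.α) :
      Transl A p → Transl A (fun a => p (A.op f (Function.update z i a)))

/-- Indistinguishability by translations. -/
def PolyRel (A : AlgStr S) (F : Set A.α) (a b : A.α) : Prop :=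
  ∀ p, Transl A p → (p a ∈ F ↔ p b ∈ F)

theorem polyRel_isCong (A : AlgStr S) (F : Set A.α) : IsCong A (PolyRel A F) := by
  refine ⟨⟨fun a p _ => Iff.rfl, fun h p hp => (h p hp).symm,
    fun h1 h2 p hp => (h1 p hp).trans (h2 p hp)⟩, ?_⟩
  intro f x y hxy p hp
  have key : ∀ k : ℕ, k ≤ S.ar f →
      (p (A.op f x) ∈ F ↔ p (A.op f (fun i => if i.1 < k then y i else x i)) ∈ F) := by
    intro k
    induction k with
    | zero => intro _; simp
    | succ k ih =>
      intro hk
      rw [ih (by omega)]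
      have h := hxy ⟨k, hk⟩ _ (Transl.step f ⟨k, hk⟩ (fun i => if i.1 < k then y i else x i) p hp)
      have e1 : Function.update (fun i : Fin (S.ar f) => if i.1 < k then y i else x i)
          ⟨k, hk⟩ (x ⟨k, hk⟩) = fun i => if i.1 < k then y i else x i := by
        funext j
        by_cases hj : j = ⟨k, hk⟩
        · subst hj; simp
        · simp [Function.update_of_ne hj]
      have e2 : Function.update (fun i : Fin (S.ar f) => if i.1 < k then y i else x i)
          ⟨k, hk⟩ (y ⟨k, hk⟩) = fun i => if i.1 < k + 1 then y i else x i := by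
        funext j
        by_cases hj : j = ⟨k, hk⟩
        · subst hj; simp
        · have : j.1 ≠ k := fun h => hj (Fin.ext h)
          rw [Function.update_of_ne hj]
          have : j.1 < k ↔ j.1 < k + 1 := by omega
          simp only [this]
      simp only [e1, e2] at h
      exact h
  have := key (S.ar f) le_rfl
  simpa using this

theorem leibniz_iff (A : AlgStr S) (F : Set A.α) (a b : A.α) :
    Leibniz A F a b ↔ PolyRel A F a b := by
  constructor
  · rintro ⟨θ, hθ, hc, hab⟩ p hp
    have : ∀ a b, θ a b → θ (p a) (p b) := by
      clear hab
      induction hp with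
      | id => intro a b h; exact h
      | step f i z p hp ih =>
        intro a b h
        apply ih
        apply hθ.2
        intro j
        by_cases hj : j = i
        · subst hj; simpa using h
        · simp only [Function.update_of_ne hj]; exact hθ.1.refl _
    exact ⟨hc _ _ (this a b hab), hc _ _ (hθ.1.symm (this a b hab))⟩
  · intro h
    exact ⟨PolyRel A F, polyRel_isCong A F, fun a b h ha => (h _ Transl.id).1 ha, h⟩

theorem leibniz_isCong (A : AlgStr S) (F : Set A.α) : IsCong A (Leibniz A F) := by
  have : Leibniz A F = PolyRel A F := by
    funext a b; exact propext (leibniz_iff A F a b)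
  rw [this]; exact polyRel_isCong A F

theorem leibniz_compat (A : AlgStr S) (F : Set A.α) : CompatWith (Leibniz A F) F := by
  rintro a b ⟨θ, _, hc, h⟩ ha
  exact hc a b h ha

theorem eval_trmAlg (σ : ℕ → Trm S) (t : Trm S) :
    Trm.eval (TrmAlg S) σ t = Trm.subst σ t := by
  induction t with
  | var n => rfl
  | app f t ih => simp only [Trm.eval, Trm.subst, TrmAlg] at *; congr 1; funext i; exact ih i

theorem eval_subst (A : AlgStr S) (v : ℕ → A.α) (σ : ℕ → Trm S) (t : Trm S) :
    Trm.eval A v (Trm.subst σ t) = Trm.eval A (fun n => Trm.eval A v (σ n)) t := by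
  induction t with
  | var n => rfl
  | app f t ih => simp only [Trm.eval, Trm.subst]; congr 1; funext i; exact ih i

theorem subst_var (t : Trm S) : Trm.subst Trm.var t = t := by
  induction t with
  | var n => rfl
  | app f t ih => simp only [Trm.subst]; congr 1; funext i; exact ih i

theorem preimage_filter (Lo : Logic S) (A : AlgStr S) (F : Set A.α) (hF : IsDedFilter Lo A F)
    (v : ℕ → A.α) : IsDedFilter Lo (TrmAlg S) {t : Trm S | Trm.eval A v t ∈ F} := by
  intro Γ φ h w hw
  have hw' : ∀ γ ∈ Γ, Trm.eval A v (Trm.eval (TrmAlg S) w γ) ∈ F := hw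
  change Trm.eval A v (Trm.eval (TrmAlg S) w φ) ∈ F
  have E : ∀ t : Trm S, Trm.eval A v (Trm.eval (TrmAlg S) w t)
      = Trm.eval A (fun n => Trm.eval A v (w n)) t := fun t =>
    (congrArg (Trm.eval A v) (eval_trmAlg w t)).trans (eval_subst A v w t)
  refine (E φ).symm ▸ hF Γ φ h _ ?_
  intro γ hγ
  exact (E γ) ▸ hw' γ hγ

theorem C_sub_theory (Lo : Logic S) (T : Set (Trm S)) (hT : IsDedFilter Lo (TrmAlg S) T)
    (Γ : Set (Trm S)) (h : Γ ⊆ T) : Lo.C Γ ⊆ T := by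
  intro φ hφ
  have := hT Γ φ hφ Trm.var (fun γ hγ => by rw [eval_trmAlg, subst_var]; exact h hγ)
  rwa [eval_trmAlg, subst_var] at this

theorem varsLT_mono {m n : ℕ} (h : m ≤ n) (t : Trm S) (ht : Trm.varsLT m t) :
    Trm.varsLT n t := by
  induction t with
  | var k => exact lt_of_lt_of_le ht h
  | app f t ih => intro i; exact ih i (ht i)

theorem exists_varsLT (t : Trm S) : ∃ n, Trm.varsLT n t := by
  induction t with
  | var k => exact ⟨k + 1, Nat.lt_succ_self k⟩
  | app f t ih =>
    choose g hg using ih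
    exact ⟨Finset.univ.sup g, fun i =>
      varsLT_mono (Finset.le_sup (f := g) (Finset.mem_univ i)) _ (hg i)⟩

theorem eval_congr_lt (A : AlgStr S) {v w : ℕ → A.α} {n : ℕ} (h : ∀ k < n, v k = w k)
    (t : Trm S) (ht : Trm.varsLT n t) : Trm.eval A v t = Trm.eval A w t := by
  induction t with
  | var k => exact h k ht
  | app f t ih => simp only [Trm.eval]; congr 1; funext i; exact ih i (ht i)

theorem transl_lift (A : AlgStr S) (p : A.α → A.α) (hp : Transl A p) :
    ∀ (N : ℕ) (h : ℕ → A.α), ∃ (h' : ℕ → A.α) (p' : Trm S → Trm S),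
      Transl (TrmAlg S) p' ∧ (∀ k < N, h' k = h k) ∧
      ∀ t, Trm.varsLT N t → Trm.eval A h' (p' t) = p (Trm.eval A h' t) := by
  induction hp with
  | id => intro N h; exact ⟨h, fun t => t, Transl.id, fun _ _ => rfl, fun _ _ => rfl⟩
  | step f i z p hp ih =>
    intro N h
    obtain ⟨h', p', hp', hag, hev⟩ := ih (N + S.ar f)
      (fun k => if hk : k - N < S.ar f ∧ N ≤ k then z ⟨k - N, hk.1⟩ else h k)
    refine ⟨h', fun t : Trm S => p' (Trm.app f
      (Function.update (β := fun _ => Trm S) (fun j => (Trm.var (N + j.1) : Trm S)) i t)),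
      Transl.step (A := TrmAlg S) f i (fun j => (Trm.var (N + j.1) : Trm S)) p' hp', ?_, ?_⟩
    · intro k hk
      rw [hag k (by omega), dif_neg (by omega)]
    · intro t ht
      rw [hev]
      · simp only [Trm.eval]
        congr 2
        funext j
        by_cases hj : j = i
        · subst hj; simp
        · rw [Function.update_of_ne hj, Function.update_of_ne hj]
          simp only [Trm.eval]
          rw [hag _ (by omega)]
          simp
      · intro j
        by_cases hj : j = i
        · subst hj
          rw [Function.update_self]
          exact varsLT_mono (by omega) t ht
        · rw [Function.update_of_ne hj]
          change N + j.1 < N + S.ar f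
          omega

/-- Soundness of the Suszko translation on any filter. -/
theorem suszko_sound (Lo : Logic S) (A : AlgStr S) (F : Set A.α) (hF : IsDedFilter Lo A F)
    (h : ℕ → A.α) (h0 : h 0 ∈ F) (φ ψ : Trm S)
    (hs : Suszko Lo (TrmAlg S) (Lo.C {Trm.var 0}) φ ψ) :
    Leibniz A F (Trm.eval A h φ) (Trm.eval A h ψ) := by
  rw [leibniz_iff]
  intro p hp
  obtain ⟨n1, hn1⟩ := exists_varsLT φ
  obtain ⟨n2, hn2⟩ := exists_varsLT ψ
  obtain ⟨h', p', hp', hag, hev⟩ := transl_lift A p hp (n1 + n2 + 1) h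
  have k1 := varsLT_mono (show n1 ≤ n1 + n2 + 1 by omega) φ hn1
  have k2 := varsLT_mono (show n2 ≤ n1 + n2 + 1 by omega) ψ hn2
  have hT := preimage_filter Lo A F hF h'
  have hL := hs _ hT (C_sub_theory Lo _ hT _ (by
    rintro _ rfl
    change h' 0 ∈ F
    rw [hag 0 (by omega)]; exact h0))
  have := (leibniz_iff (TrmAlg S) _ _ _).1 hL p' hp'
  change Trm.eval A h' (p' φ) ∈ F ↔ Trm.eval A h' (p' ψ) ∈ F at this
  rw [hev φ k1, hev ψ k2, eval_congr_lt A hag φ k1, eval_congr_lt A hag ψ k2] at this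
  exact this

theorem suszko_almostDefines (Lo : Logic S)
    (H : ComplOrderReflOn (TrmAlg S) {Γ | Γ ∈ Theories Lo ∧ Γ.Nonempty}) :
    AlmostDefinesTruth Lo
        {e : Trm S × Trm S | Suszko Lo (TrmAlg S) (Lo.C {Trm.var 0}) e.1 e.2} := by
  intro A F hF hR hne
  ext a
  constructor
  · intro ha
    obtain ⟨b, hb⟩ := hne
    let v : ℕ → A.α := Function.update (fun _ => b) 0 a
    have hT := preimage_filter Lo A F hF v
    have := H {T | IsDedFilter Lo (TrmAlg S) T ∧ Lo.C {Trm.var 0} ⊆ T}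
      {t : Trm S | Trm.eval A v t ∈ F}
      (fun T hT => ⟨hT.1, ⟨Trm.var 0, hT.2 (Lo.extensive _ rfl)⟩⟩)
      ⟨hT, ⟨Trm.var 1, by
        change v 1 ∈ F
        simpa [v] using hb⟩⟩
      (by
        intro s t hst
        have e : Trm.eval A v s = Trm.eval A v t :=
          ha (fun _ => b) (s, t) (fun G hG hs => hst G ⟨hG, hs⟩)
        refine ⟨fun s t => Trm.eval A v s = Trm.eval A v t,
          ⟨⟨fun _ => rfl, fun h => h.symm, fun h1 h2 => h1.trans h2⟩, ?_⟩, ?_, e⟩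
        · intro f x y hxy
          change A.op f _ = A.op f _
          congr 1
          funext i
          exact hxy i
        · intro s t hst hs
          change Trm.eval A v t ∈ F
          rw [← hst]; exact hs)
    have h0 : Trm.eval A v (Trm.var 0) ∈ F :=
      this (a := Trm.var 0) (fun T hT => hT.2 (Lo.extensive _ rfl))
    simpa [Trm.eval, v] using h0
  · intro ha v e he
    exact (hR _ _).1 (suszko_sound Lo A F hF _ (by simpa using ha) e.1 e.2 he)

/-! Quotients by the Leibniz congruence. -/

theorem quot_eq_iff (A : AlgStr S) (F : Set A.α) (a b : A.α) :
    Quot.mk (Leibniz A F) a = Quot.mk (Leibniz A F) b ↔ Leibniz A F a b :=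
  (leibniz_isCong A F).1.quot_mk_eq_iff a b

theorem quot_op (A : AlgStr S) (F : Set A.α) (f : S.F) (x : Fin (S.ar f) → A.α) :
    (quotAlg A (Leibniz A F)).op f (fun i => Quot.mk _ (x i)) = Quot.mk _ (A.op f x) := by
  change Quot.mk _ _ = Quot.mk _ _
  rw [quot_eq_iff]
  apply (leibniz_isCong A F).2
  intro i
  rw [← quot_eq_iff]
  exact Quot.out_eq _

theorem quot_eval (A : AlgStr S) (F : Set A.α) (v : ℕ → A.α) (t : Trm S) :
    Trm.eval (quotAlg A (Leibniz A F)) (fun n => Quot.mk _ (v n)) t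
      = Quot.mk _ (Trm.eval A v t) := by
  induction t with
  | var n => rfl
  | app f t ih =>
    simp only [Trm.eval]
    rw [← quot_op]
    congr 1
    funext i
    exact ih i

theorem quot_mem (A : AlgStr S) (F : Set A.α) (a : A.α) :
    Quot.mk (Leibniz A F) a ∈ Quot.mk (Leibniz A F) '' F ↔ a ∈ F := by
  constructor
  · rintro ⟨b, hb, e⟩
    exact leibniz_compat A F b a ((quot_eq_iff A F b a).1 e) hb
  · intro h; exact ⟨a, h, rfl⟩

theorem quot_lift_val (A : AlgStr S) (F : Set A.α) (v : ℕ → (quotAlg A (Leibniz A F)).α) :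
    ∃ w : ℕ → A.α, v = fun n => Quot.mk _ (w n) :=
  ⟨fun n => Quot.out (v n), by funext n; exact (Quot.out_eq _).symm⟩

theorem quot_filter (Lo : Logic S) (A : AlgStr S) (F : Set A.α) (hF : IsDedFilter Lo A F) :
    IsDedFilter Lo (quotAlg A (Leibniz A F)) (Quot.mk (Leibniz A F) '' F) := by
  intro Γ φ h v hv
  obtain ⟨w, rfl⟩ := quot_lift_val A F v
  rw [quot_eval]
  refine (quot_mem A F _).2 (hF Γ φ h w fun γ hγ => ?_)
  have := hv γ hγ
  rw [quot_eval] at this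
  exact (quot_mem A F _).1 this

theorem quot_reduced (A : AlgStr S) (F : Set A.α) :
    IsReducedMatrix (quotAlg A (Leibniz A F)) (Quot.mk (Leibniz A F) '' F) := by
  intro a b
  constructor
  · rintro ⟨θ, hθ, hc, hab⟩
    obtain ⟨a, rfl⟩ := Quot.exists_rep a
    obtain ⟨b, rfl⟩ := Quot.exists_rep b
    refine (quot_eq_iff A F a b).2 ⟨fun a b => θ (Quot.mk _ a) (Quot.mk _ b),
      ⟨⟨fun _ => hθ.1.refl _, fun h => hθ.1.symm h, fun h1 h2 => hθ.1.trans h1 h2⟩, ?_⟩, ?_, hab⟩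
    · intro f x y hxy
      rw [← quot_op, ← quot_op]
      exact hθ.2 f _ _ hxy
    · intro a b h ha
      exact (quot_mem A F b).1 (hc _ _ h ((quot_mem A F a).2 ha))
  · rintro rfl
    exact (leibniz_isCong _ _).1.refl _

theorem definable_mem (Lo : Logic S) (τ : Set (Trm S × Trm S)) (hτ : AlmostDefinesTruth Lo τ)
    (A : AlgStr S) (F : Set A.α) (hF : IsDedFilter Lo A F) (hne : F.Nonempty) (a : A.α) :
    a ∈ F ↔ ∀ v : ℕ → A.α, ∀ e ∈ τ, Leibniz A F (Trm.eval A (Function.update v 0 a) e.1)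
      (Trm.eval A (Function.update v 0 a) e.2) := by
  have h := hτ _ _ (quot_filter Lo A F hF) (quot_reduced A F) (hne.image _)
  have upd : ∀ v : ℕ → A.α, Function.update (fun n => Quot.mk (Leibniz A F) (v n)) 0
      (Quot.mk _ a) = fun n => Quot.mk _ (Function.update v 0 a n) := by
    intro v
    funext n
    by_cases hn : n = 0
    · subst hn; simp
    · simp [Function.update_of_ne hn]
  have h2 : a ∈ F ↔ (Quot.mk (Leibniz A F) a : (quotAlg A (Leibniz A F)).α) ∈
      solSet (quotAlg A (Leibniz A F)) τ := by
    rw [h]; exact (quot_mem A F a).symm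
  rw [h2]
  constructor
  · intro ha v e he
    have := ha (fun n => Quot.mk _ (v n)) e he
    erw [upd v, quot_eval, quot_eval] at this
    exact (quot_eq_iff A F _ _).1 this
  · intro H v e he
    obtain ⟨w, rfl⟩ := quot_lift_val A F v
    erw [upd w, quot_eval, quot_eval]
    exact (quot_eq_iff A F _ _).2 (H w e he)

theorem complOrderRefl_of_definable (Lo : Logic S)
    (h : ∃ τ : Set (Trm S × Trm S), AlmostDefinesTruth Lo τ) (A : AlgStr S) :
    ComplOrderReflOn A {F | IsDedFilter Lo A F ∧ F.Nonempty} := by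
  obtain ⟨τ, hτ⟩ := h
  intro Fam G hFam hG hsub a ha
  rw [definable_mem Lo τ hτ A G hG.1 hG.2]
  intro v e he
  apply hsub
  intro F hF
  exact (definable_mem Lo τ hτ A F (hFam hF).1 (hFam hF).2 a).1 (ha F hF) v e he

/-- truth is almost parametrically equationally definable in `Mod* L`
iff the Leibniz operator is (almost) completely order-reflecting on the non-empty
deductive filters over every algebra, iff it is so on the non-empty theories;
moreover, in that case `τ(x,ȳ) := Ω̃_L C_L{x}` almost defines truth in `Mod* L`. -/
theorem almostParamEqDefinable_iff_complOrderRefl {S : AlgSig.{u}} (Lo : Logic S) :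
    ((∃ τ : Set (Trm S × Trm S), AlmostDefinesTruth Lo τ) ↔
      ∀ A : AlgStr S, ComplOrderReflOn A {F | IsDedFilter Lo A F ∧ F.Nonempty}) ∧
    ((∀ A : AlgStr S, ComplOrderReflOn A {F | IsDedFilter Lo A F ∧ F.Nonempty}) ↔
      ComplOrderReflOn (TrmAlg S) {Γ | Γ ∈ Theories Lo ∧ Γ.Nonempty}) ∧
    ((∃ τ : Set (Trm S × Trm S), AlmostDefinesTruth Lo τ) →
      AlmostDefinesTruth Lo
        {e : Trm S × Trm S | Suszko Lo (TrmAlg S) (Lo.C {Trm.var 0}) e.1 e.2}) := by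
  have h12 := complOrderRefl_of_definable Lo
  have h31 := suszko_almostDefines Lo
  exact ⟨⟨h12, fun h => ⟨_, h31 (h (TrmAlg S))⟩⟩,
    ⟨fun h => h (TrmAlg S), fun h => h12 ⟨_, h31 h⟩⟩,
    fun h => h31 (h12 h (TrmAlg S))⟩
end

section
/- A Fregean logic L has theorems if and only if truth is equationally definable in Mod* L. -/
universe u

variable {S : AlgSig.{u}}

variable {S : AlgSig.{u}}

theorem aux_eval_subst {S : AlgSig.{u}} (A : AlgStr S) (v : ℕ → A.α) (σ : ℕ → Trm S) (t : Trm S) :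
    Trm.eval A v (Trm.subst σ t) = Trm.eval A (fun n => Trm.eval A v (σ n)) t := by
  induction t with
  | var n => rfl
  | app f t ih => simp only [Trm.subst, Trm.eval, ih]

theorem aux_cong_subst {S : AlgSig.{u}} (θ : Trm S → Trm S → Prop) (h : IsCong (TrmAlg S) θ)
    (σ σ' : ℕ → Trm S) (hs : ∀ n, θ (σ n) (σ' n)) (t : Trm S) :
    θ (Trm.subst σ t) (Trm.subst σ' t) := by
  induction t with
  | var n => exact hs n
  | app f t ih => exact h.2 f _ _ ih

/-- Polynomial indiscernibility. -/
def auxRel {S : AlgSig.{u}} (A : AlgStr S) (F : Set A.α) (a b : A.α) : Prop :=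
  ∀ (φ : Trm S) (n : ℕ) (v : ℕ → A.α),
    Trm.eval A (Function.update v n a) φ ∈ F ↔ Trm.eval A (Function.update v n b) φ ∈ F

theorem auxRel_hyb {S : AlgSig.{u}} (A : AlgStr S) (F : Set A.α) (k : ℕ) (x y w : ℕ → A.α)
    (h : ∀ i < k, auxRel A F (x i) (y i)) (φ : Trm S) (j : ℕ) (hj : j ≤ k) :
    Trm.eval A (fun m => if m < k then x m else w m) φ ∈ F ↔
    Trm.eval A (fun m => if m < j then y m else if m < k then x m else w m) φ ∈ F := by
  induction j with
  | zero => simp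
  | succ j ih =>
    rw [ih (by omega)]
    have := h j (by omega) φ j (fun m => if m < j then y m else if m < k then x m else w m)
    convert this using 3
    · funext m
      by_cases hm : m = j
      · subst hm; simp; omega
      · simp [hm]
    · funext m
      by_cases hm : m = j
      · subst hm; simp
      · have : m < j + 1 ↔ m < j := by omega
        simp [hm, this]

theorem auxRel_cong {S : AlgSig.{u}} (A : AlgStr S) (F : Set A.α) : IsCong A (auxRel A F) := by
  refine ⟨⟨fun a φ n v => Iff.rfl, fun h φ n v => (h φ n v).symm,
    fun h h' φ n v => (h φ n v).trans (h' φ n v)⟩, ?_⟩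
  intro f x y h φ n v
  let k := S.ar f
  let x' : ℕ → A.α := fun m => if hm : m < k then x ⟨m, hm⟩ else v m
  let y' : ℕ → A.α := fun m => if hm : m < k then y ⟨m, hm⟩ else v m
  let w : ℕ → A.α := fun m => v (m - k)
  let σ : ℕ → Trm S := fun m => if m = n then .app f (fun i => .var i.1) else .var (m + k)
  have key := auxRel_hyb A F k x' y' w (by
    intro i hi
    simp only [x', y', hi, dif_pos]
    exact h _) (Trm.subst σ φ) k le_rfl
  rw [aux_eval_subst, aux_eval_subst] at key
  convert key using 3
  · funext m
    by_cases hm : m = n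
    · subst hm
      simp [σ, Trm.eval, x', k]
    · simp [σ, hm, Trm.eval, w]
  · funext m
    by_cases hm : m = n
    · subst hm
      simp [σ, Trm.eval, y', k]
    · simp [σ, hm, Trm.eval, w]

theorem auxRel_of_mem {S : AlgSig.{u}} (Lo : Logic S) (hFr : Fregean Lo) (A : AlgStr S)
    (F : Set A.α) (hF : IsDedFilter Lo A F) (a b : A.α) (ha : a ∈ F) (hb : b ∈ F) :
    auxRel A F a b := by
  intro φ n v
  let Γ : Set (Trm S) := {Trm.var 0, Trm.var 1}
  let σ : ℕ → Trm S := fun m => if m = n then .var 0 else .var (m + 2)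
  let σ' : ℕ → Trm S := fun m => if m = n then .var 1 else .var (m + 2)
  have hc := hFr Γ
  have hrel := aux_cong_subst _ hc σ σ' (by
    intro m
    by_cases hm : m = n
    · simp only [σ, σ', hm, if_true]
      exact ⟨Lo.extensive _ (by simp [Γ]), Lo.extensive _ (by simp [Γ])⟩
    · simp only [σ, σ', hm, if_false]
      exact hc.1.refl _) φ
  let w : ℕ → A.α := fun m => if m = 0 then a else if m = 1 then b else v (m - 2)
  have e1 : Trm.eval A w (Trm.subst σ φ) = Trm.eval A (Function.update v n a) φ := by
    rw [aux_eval_subst]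
    congr 1
    funext m
    by_cases hm : m = n
    · subst hm; simp [σ, Trm.eval, w]
    · simp [σ, hm, Trm.eval, w]
  have e2 : Trm.eval A w (Trm.subst σ' φ) = Trm.eval A (Function.update v n b) φ := by
    rw [aux_eval_subst]
    congr 1
    funext m
    by_cases hm : m = n
    · subst hm; simp [σ', Trm.eval, w]
    · simp [σ', hm, Trm.eval, w]
  have e0 : Trm.eval A w (.var 0) ∈ F := by simpa [Trm.eval, w] using ha
  have e1' : Trm.eval A w (.var 1) ∈ F := by simpa [Trm.eval, w] using hb
  rw [← e1, ← e2]
  constructor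
  · intro h
    refine hF _ _ hrel.1 w ?_
    rintro γ ((rfl | rfl) | rfl)
    exacts [e0, e1', h]
  · intro h
    refine hF _ _ hrel.2 w ?_
    rintro γ ((rfl | rfl) | rfl)
    exacts [e0, e1', h]

theorem aux_noParams {S : AlgSig.{u}} (t : Trm S) :
    Trm.noParams (Trm.subst (fun _ => Trm.var 0) t) := by
  induction t with
  | var n => simp [Trm.subst, Trm.noParams]
  | app f t ih => exact ih

/-- a Fregean logic has theorems iff truth is equationally definable in
`Mod* L`. -/
theorem fregean_theorems_iff_eqDefinable {S : AlgSig.{u}} (Lo : Logic S)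
    (hFr : Fregean Lo) :
    (Lo.C ∅).Nonempty ↔
      ∃ τ : Set (Trm S × Trm S), IsEqTranslation τ ∧ DefinesTruth Lo τ := by
  constructor
  · rintro ⟨t, ht⟩
    let T : Trm S := Trm.subst (fun _ => Trm.var 0) t
    have hT : T ∈ Lo.C ∅ := by
      have := Lo.structural (fun _ => Trm.var 0) ∅ ⟨t, ht, rfl⟩
      simpa using this
    refine ⟨{(Trm.var 0, T)}, ?_, ?_⟩
    · rintro e rfl
      exact ⟨rfl, aux_noParams t⟩
    · intro A F hF hR
      have hTF : ∀ v : ℕ → A.α, Trm.eval A v T ∈ F := fun v => hF ∅ T hT v (by simp)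
      ext a
      constructor
      · intro h
        have := h (fun _ => a) _ rfl
        simp only [Trm.eval, Function.update_self] at this
        rw [this]
        exact hTF _
      · rintro ha v e rfl
        refine (hR _ _).1 ⟨auxRel A F, auxRel_cong A F, ?_, ?_⟩
        · intro c d h hc
          have := h (.var 0) 0 (fun _ => c)
          simp only [Trm.eval, Function.update_self] at this
          exact this.1 hc
        · refine auxRel_of_mem Lo hFr A F hF _ _ ?_ (hTF _)
          simpa [Trm.eval] using ha
  · rintro ⟨τ, -, hτ⟩
    by_contra hne
    rw [Set.not_nonempty_iff_eq_empty] at hne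
    let A : AlgStr S := ⟨PUnit, fun _ _ => PUnit.unit⟩
    have hR : ∀ F : Set A.α, IsReducedMatrix A F := by
      intro F a b
      refine ⟨fun _ => rfl, ?_⟩
      rintro rfl
      exact ⟨Eq, ⟨eq_equivalence, fun _ _ _ _ => rfl⟩, fun a b h => h ▸ id, rfl⟩
    have h1 := hτ A Set.univ (fun _ _ _ _ _ => trivial) (hR _)
    have h2 := hτ A ∅ (by
      intro Γ φ hφ v hv
      have : Γ = ∅ := Set.eq_empty_of_forall_notMem fun γ hγ => hv γ hγ
      rw [this, hne] at hφ
      exact hφ.elim) (hR _)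
    have h3 : (PUnit.unit : A.α) ∈ (∅ : Set A.α) := by
      rw [← h2, h1]; trivial
    exact h3
end
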